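/- Let f be a C¹ expanding map of the circle. Then f has no atomic ergodic observable measure: there is no f-invariant Borel probability measure on the circle that is simultaneously ergodic, supported on a finite set, and observable. -/

import Mathlib

open MeasureTheory Filter Set Topology
open scoped ENNReal NNReal

/-- A metric on a topological space `P` (here: the space `𝒫` of Borel probability
measures with the weak* topology) inducing its topology; `d` plays the role of `dist*`. -/
structure CompatibleMetric (P : Type*) [TopologicalSpace P] where
  d : P → P → ℝ
  symm : ∀ x y, d x y = d y x
  triangle : ∀ x y z, d x z ≤ d x y + d y z
  eq_iff_dist_eq_zero : ∀ x y, d x y = 0 ↔ x = y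
  nhds_iff : ∀ (x : P) (s : Set P), s ∈ nhds x ↔ ∃ ε > 0, {y | d x y < ε} ⊆ s

/-- The diameter of a set of measures w.r.t. the metric `D.d`. -/
noncomputable def diamD {P : Type*} [TopologicalSpace P] (D : CompatibleMetric P)
    (A : Set P) : ℝ :=
  sSup (Set.image2 D.d A A)

variable {M : Type*} [MeasurableSpace M] [TopologicalSpace M] [OpensMeasurableSpace M]

/-- The empirical measure `σ_{n+1,x} = (1/(n+1)) ∑_{j=0}^{n} δ_{f^j(x)}`
(index shifted so that it is defined for every `n : ℕ`). -/
noncomputable def empiric (f : M → M) (x : M) (n : ℕ) : ProbabilityMeasure M :=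
  ⟨((n : ℝ≥0∞) + 1)⁻¹ • ∑ j ∈ Finset.range (n + 1), Measure.dirac (f^[j] x), by
    constructor
    rw [Measure.smul_apply, Measure.finset_sum_apply]
    simp only [measure_univ, Finset.sum_const, Finset.card_range, nsmul_eq_mul, mul_one,
      smul_eq_mul]
    rw [Nat.cast_add, Nat.cast_one]
    exact ENNReal.inv_mul_cancel (by simp)
      (ENNReal.add_ne_top.2 ⟨ENNReal.natCast_ne_top n, ENNReal.one_ne_top⟩)⟩

/-- `pω(x)`: the set of weak* limit points of the sequence of empirical measures
of the orbit of `x`. -/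
def pomega (f : M → M) (x : M) : Set (ProbabilityMeasure M) :=
  {μ | MapClusterPt μ atTop (empiric f x)}

/-- The basin of attraction `B(K) = {x : pω(x) ⊆ K}` of a set of probability measures. -/
def basin (f : M → M) (K : Set (ProbabilityMeasure M)) : Set M :=
  {x | pomega f x ⊆ K}

/-- `μ` is observable: for all `ε > 0` the `ε`-basin of partial attraction
`A_ε(μ) = {x : dist*(pω(x), μ) < ε}` has positive `m`-measure. -/
def Observable (D : CompatibleMetric (ProbabilityMeasure M)) (m : Measure M)
    (f : M → M) (μ : ProbabilityMeasure M) : Prop :=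
  ∀ ε > 0, 0 < m {x | ∃ ν ∈ pomega f x, D.d ν μ < ε}

/-- `μ` is a physical measure: its basin `{x : pω(x) = {μ}}` has positive `m`-measure. -/
def PhysicalMeasure (m : Measure M) (f : M → M) (μ : ProbabilityMeasure M) : Prop :=
  0 < m {x | pomega f x = {μ}}

/-- A generalized attractor (reduction of the set `𝒪` of observable measures): a nonempty
weak*-compact set of observable measures whose basin has positive `m`-measure. -/
def GenAttractor (D : CompatibleMetric (ProbabilityMeasure M)) (m : Measure M)
    (f : M → M) (A : Set (ProbabilityMeasure M)) : Prop :=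
  A.Nonempty ∧ IsCompact A ∧ (∀ μ ∈ A, Observable D m f μ) ∧ 0 < m (basin f A)

/-- Two generalized attractors are independent if the basin of their intersection is null. -/
def IndepGA (m : Measure M) (f : M → M) (A B : Set (ProbabilityMeasure M)) : Prop :=
  m (basin f (A ∩ B)) = 0

/-- A co-chain: an (at most countable) family of pairwise independent generalized attractors. -/
def IsCochain (D : CompatibleMetric (ProbabilityMeasure M)) (m : Measure M) (f : M → M)
    (S : Set (Set (ProbabilityMeasure M))) : Prop :=
  S.Countable ∧ (∀ A ∈ S, GenAttractor D m f A) ∧ S.Pairwise (IndepGA m f)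

/-- A chain: a (finite or countably infinite) sequence, indexed by `I ⊆ ℕ`, of generalized
attractors that is strictly decreasing under inclusion. -/
def IsChainGA (D : CompatibleMetric (ProbabilityMeasure M)) (m : Measure M) (f : M → M)
    (I : Set ℕ) (c : ℕ → Set (ProbabilityMeasure M)) : Prop :=
  I.Nonempty ∧ (∀ i ∈ I, GenAttractor D m f (c i)) ∧
    ∀ i ∈ I, ∀ j ∈ I, j < i → c i ⊂ c j

/-- Two chains are independent if each contains a member independent of some member
of the other. -/
def IndepChainPair (m : Measure M) (f : M → M)
    (p q : Set ℕ × (ℕ → Set (ProbabilityMeasure M))) : Prop :=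
  (∃ i ∈ p.1, ∃ j ∈ q.1, IndepGA m f (p.2 i) (q.2 j)) ∧
    (∃ j ∈ q.1, ∃ i ∈ p.1, IndepGA m f (q.2 j) (p.2 i))

/-- `k`: the supremum of the lengths (cardinalities) of co-chains of generalized attractors. -/
noncomputable def cochainSup (D : CompatibleMetric (ProbabilityMeasure M)) (m : Measure M)
    (f : M → M) : Cardinal :=
  sSup {c : Cardinal | ∃ S, IsCochain D m f S ∧ c = Cardinal.mk S}

/-- `h`: the supremum of the cardinalities of (at most countable) families of pairwise
independent chains of generalized attractors. -/
noncomputable def indepChainFamilySup (D : CompatibleMetric (ProbabilityMeasure M))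
    (m : Measure M) (f : M → M) : Cardinal :=
  sSup {c : Cardinal | ∃ F : Set (Set ℕ × (ℕ → Set (ProbabilityMeasure M))),
    F.Countable ∧ (∀ p ∈ F, IsChainGA D m f p.1 p.2) ∧ F.Pairwise (IndepChainPair m f) ∧
    c = Cardinal.mk F}

/-- An irreducible generalized attractor: one containing no proper compact subset that is
itself a generalized attractor. -/
def IrreducibleGA (D : CompatibleMetric (ProbabilityMeasure M)) (m : Measure M) (f : M → M)
    (A : Set (ProbabilityMeasure M)) : Prop :=
  GenAttractor D m f A ∧ ∀ K, IsCompact K → K ⊂ A → ¬ GenAttractor D m f K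

/-- A measurable set of reals that injects into a measurable subset of the circle has at most
the measure of that subset. -/
lemma volume_le_of_injOn_coe {T : Set ℝ} (hT : MeasurableSet T)
    (hinj : InjOn ((↑) : ℝ → UnitAddCircle) T) {B : Set UnitAddCircle} (hB : MeasurableSet B)
    (hTB : MapsTo ((↑) : ℝ → UnitAddCircle) T B) : volume T ≤ volume B := by
  have hfd := isAddFundamentalDomain_Ioc (T := (1 : ℝ)) one_pos 0
  have hcoe : ∀ (g : AddSubgroup.zmultiples (1 : ℝ)) (x : ℝ),
      ((g +ᵥ x : ℝ) : UnitAddCircle) = x := by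
    rintro ⟨_, n, rfl⟩ x
    simp [AddSubgroup.vadd_def]
  rw [hfd.measure_eq_tsum T, ← measure_iUnion]
  · rw [← (UnitAddCircle.measurePreserving_mk 0).measure_preimage hB.nullMeasurableSet,
      Measure.restrict_apply (AddCircle.measurable_mk' hB)]
    refine measure_mono (iUnion_subset fun g => ?_)
    rintro _ ⟨⟨x, hx, rfl⟩, hx'⟩
    refine ⟨?_, hx'⟩
    change ((g +ᵥ x : ℝ) : UnitAddCircle) ∈ B
    rw [hcoe]
    exact hTB hx
  · intro g h hgh
    rw [Function.onFun, Set.disjoint_left]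
    rintro _ ⟨⟨x, hx, rfl⟩, -⟩ ⟨⟨y, hy, hxy⟩, -⟩
    have hxy : h +ᵥ y = g +ᵥ x := hxy
    have h1 : (y : UnitAddCircle) = x := by rw [← hcoe h y, hxy, hcoe]
    rw [hinj hy hx h1] at hxy
    refine hgh (Subtype.ext ?_)
    simpa [AddSubgroup.vadd_def] using hxy.symm
  · exact fun g => (hT.const_vadd g).inter measurableSet_Ioc

section Lift

variable {f : UnitAddCircle → UnitAddCircle} {F : ℝ → ℝ}

lemma continuous_of_lift (hF : Continuous F)
    (hlift : ∀ x : ℝ, f (x : UnitAddCircle) = ((F x : ℝ) : UnitAddCircle)) : Continuous f := by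
  refine (QuotientAddGroup.isQuotientMap_mk
    (N := AddSubgroup.zmultiples (1 : ℝ))).continuous_iff.2 ?_
  have : f ∘ ((↑) : ℝ → UnitAddCircle) = fun x => ((F x : ℝ) : UnitAddCircle) := funext hlift
  exact this ▸ (AddCircle.continuous_mk' (1 : ℝ)).comp hF

lemma exists_mem_nhds_injOn_of_lift (hF : Continuous F) (hFinj : Function.Injective F)
    (hlift : ∀ x : ℝ, f (x : UnitAddCircle) = ((F x : ℝ) : UnitAddCircle)) (x : UnitAddCircle) :
    ∃ u ∈ 𝓝 x, InjOn f u := by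
  obtain ⟨a, rfl⟩ := QuotientAddGroup.mk_surjective x
  have hopen : IsOpen {t : ℝ | |F t - F a| < 1 / 2} :=
    isOpen_lt (by fun_prop) continuous_const
  refine ⟨((↑) : ℝ → UnitAddCircle) '' {t : ℝ | |F t - F a| < 1 / 2},
    (QuotientAddGroup.isOpenMap_coe _ hopen).mem_nhds ⟨a, by simp, rfl⟩, ?_⟩
  rintro _ ⟨s, hs, rfl⟩ _ ⟨t, ht, rfl⟩ hst
  rw [hlift, hlift, ← sub_eq_zero, ← AddCircle.coe_sub, AddCircle.coe_eq_zero_iff] at hst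
  obtain ⟨n, hn⟩ := hst
  rw [zsmul_eq_mul, mul_one] at hn
  have hs' := abs_lt.1 (mem_ofPred.1 hs)
  have ht' := abs_lt.1 (mem_ofPred.1 ht)
  have h1 : (n : ℝ) < 1 := by linarith
  have h2 : (-1 : ℝ) < n := by linarith
  have h3 : n = 0 := by
    have h1' : n < 1 := by exact_mod_cast h1
    have h2' : -1 < n := by exact_mod_cast h2
    omega
  rw [h3, Int.cast_zero] at hn
  rw [hFinj (sub_eq_zero.1 hn.symm)]

variable {l : ℝ}

lemma mul_volume_inter_preimage_le (hF : Differentiable ℝ F) (hFinj : Function.Injective F)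
    (hl : ∀ x ∈ Icc (0 : ℝ) 1, l ≤ deriv F x)
    (hlift : ∀ x : ℝ, f (x : UnitAddCircle) = ((F x : ℝ) : UnitAddCircle))
    {V : Set UnitAddCircle} (hV : MeasurableSet V) (hVinj : InjOn f V)
    {B : Set UnitAddCircle} (hB : MeasurableSet B) :
    ENNReal.ofReal l * volume (f ⁻¹' B ∩ V) ≤ volume B := by
  have hfm : Measurable f := (continuous_of_lift hF.continuous hlift).measurable
  set S : Set ℝ := ((↑) : ℝ → UnitAddCircle) ⁻¹' (f ⁻¹' B ∩ V) ∩ Ioc 0 1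
  have hSm : MeasurableSet S :=
    (AddCircle.measurable_mk' ((hfm hB).inter hV)).inter measurableSet_Ioc
  have hvol : volume (f ⁻¹' B ∩ V) = volume S := by
    rw [← (UnitAddCircle.measurePreserving_mk 0).measure_preimage
      ((hfm hB).inter hV).nullMeasurableSet,
      Measure.restrict_apply (AddCircle.measurable_mk' ((hfm hB).inter hV)), zero_add]
  have himage : ENNReal.ofReal l * volume S ≤ volume (F '' S) := by
    rw [← setLIntegral_one (F '' S), lintegral_image_eq_lintegral_abs_deriv_mul hSm
      (fun x _ => (hF x).hasDerivAt.hasDerivWithinAt) hFinj.injOn, ← setLIntegral_const]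
    refine setLIntegral_mono' hSm fun x hx => ?_
    rw [mul_one]
    exact ENNReal.ofReal_le_ofReal ((hl x (Ioc_subset_Icc_self hx.2)).trans (le_abs_self _))
  rw [hvol]
  refine himage.trans (volume_le_of_injOn_coe
    (hSm.image_of_continuousOn_injOn hF.continuous.continuousOn hFinj.injOn) ?_ hB ?_)
  · rintro _ ⟨x, hx, rfl⟩ _ ⟨y, hy, rfl⟩ hxy
    rw [← hlift, ← hlift] at hxy
    have h1 := hVinj hx.1.2 hy.1.2 hxy
    have hx' := hx.2
    have hy' := hy.2
    rw [← zero_add (1 : ℝ)] at hx' hy'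
    rw [(AddCircle.coe_eq_coe_iff_of_mem_Ioc hx' hy').1 h1]
  · rintro _ ⟨x, hx, rfl⟩
    rw [← hlift]
    exact hx.1.1

lemma setLIntegral_comp_le_of_injOn (hF : Differentiable ℝ F) (hFinj : Function.Injective F)
    (hl0 : 0 < l) (hl : ∀ x ∈ Icc (0 : ℝ) 1, l ≤ deriv F x)
    (hlift : ∀ x : ℝ, f (x : UnitAddCircle) = ((F x : ℝ) : UnitAddCircle))
    {V : Set UnitAddCircle} (hV : MeasurableSet V) (hVinj : InjOn f V)
    {g : UnitAddCircle → ℝ≥0∞} (hg : Measurable g) :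
    ∫⁻ x in V, g (f x) ≤ ENNReal.ofReal l⁻¹ * ∫⁻ x, g x := by
  have hfm : Measurable f := (continuous_of_lift hF.continuous hlift).measurable
  have hle : (volume.restrict V).map f ≤ ENNReal.ofReal l⁻¹ • volume := by
    refine Measure.le_iff.2 fun B hB => ?_
    rw [Measure.map_apply hfm hB, Measure.restrict_apply (hfm hB), Measure.smul_apply,
      smul_eq_mul, ENNReal.ofReal_inv_of_pos hl0, mul_comm, ← div_eq_mul_inv,
      ENNReal.le_div_iff_mul_le (by simp [hl0]) (by simp), mul_comm]
    exact mul_volume_inter_preimage_le hF hFinj hl hlift hV hVinj hB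
  rw [← lintegral_map hg hfm, ← smul_eq_mul, ← lintegral_smul_measure]
  exact lintegral_mono' hle le_rfl

lemma exists_lintegral_comp_le (hF : Differentiable ℝ F) (hFinj : Function.Injective F)
    (hl0 : 0 < l) (hl : ∀ x ∈ Icc (0 : ℝ) 1, l ≤ deriv F x)
    (hlift : ∀ x : ℝ, f (x : UnitAddCircle) = ((F x : ℝ) : UnitAddCircle)) :
    ∃ b : ℝ, 0 ≤ b ∧ ∀ g : UnitAddCircle → ℝ≥0∞, Measurable g →
      ∫⁻ x, g (f x) ≤ ENNReal.ofReal b * ∫⁻ x, g x := by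
  choose u hu hinj using exists_mem_nhds_injOn_of_lift hF.continuous hFinj hlift
  obtain ⟨t, ht⟩ := finite_cover_nhds_interior hu
  refine ⟨t.card * l⁻¹, by positivity, fun g hg => ?_⟩
  calc ∫⁻ x, g (f x) = ∫⁻ x in ⋃ i : t, interior (u i), g (f x) := by
        rw [iUnion_subtype, ht, Measure.restrict_univ]
    _ ≤ ∑' i : t, ∫⁻ x in interior (u i), g (f x) := lintegral_iUnion_le _ _
    _ = ∑ i ∈ t, ∫⁻ x in interior (u i), g (f x) := by
        rw [tsum_fintype, Finset.sum_coe_sort t fun i => ∫⁻ x in interior (u i), g (f x)]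
    _ ≤ ∑ i ∈ t, ENNReal.ofReal l⁻¹ * ∫⁻ x, g x := Finset.sum_le_sum fun i _ =>
        setLIntegral_comp_le_of_injOn hF hFinj hl0 hl hlift isOpen_interior.measurableSet
          ((hinj i).mono interior_subset) hg
    _ = _ := by
        rw [Finset.sum_const, nsmul_eq_mul, ENNReal.ofReal_mul (by positivity),
          ENNReal.ofReal_natCast, mul_assoc]

end Lift

/-- The points of positive mass of an invariant measure supported on a finite set are permuted. -/
lemma exists_injOn_of_invariant_of_finite {X : Type*} [MeasurableSpace X] [MeasurableSingletonClass X]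
    {f : X → X} {μ : Measure X}
    (hinv : ∀ E, MeasurableSet E → μ (f ⁻¹' E) = μ E) {A : Set X} (hA : A.Finite)
    (hμ : μ Aᶜ = 0) :
    ∃ P : Set X, P.Finite ∧ μ Pᶜ = 0 ∧ InjOn f P := by
  set P : Set X := {x ∈ A | μ {x} ≠ 0}
  have hPfin : P.Finite := hA.subset (sep_subset _ _)
  have hmem : ∀ x, μ {x} ≠ 0 → x ∈ P := fun x hx => by
    refine ⟨?_, hx⟩
    by_contra hxA
    exact hx (measure_mono_null (singleton_subset_iff.2 hxA) hμ)
  have hPnull : μ Pᶜ = 0 := by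
    have hsub : Pᶜ ⊆ Aᶜ ∪ {x ∈ A | μ {x} = 0} := by
      intro x hx
      by_cases hxA : x ∈ A
      · exact Or.inr ⟨hxA, by by_contra h; exact hx ⟨hxA, h⟩⟩
      · exact Or.inl hxA
    refine measure_mono_null hsub (measure_union_null hμ ?_)
    rw [← biUnion_of_singleton {x ∈ A | μ {x} = 0}]
    exact (measure_biUnion_null_iff (hA.subset (sep_subset _ _)).countable).2 fun x hx => hx.2
  refine ⟨P, hPfin, hPnull, ?_⟩
  have hmaps : MapsTo f P P := fun x hx => hmem _ fun h0 => hx.2 <| by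
    rw [← hinv _ (measurableSet_singleton _)] at h0
    exact measure_mono_null (by simp) h0
  have hsurj : SurjOn f P P := by
    intro y hy
    by_contra hne
    refine hy.2 ?_
    rw [← hinv _ (measurableSet_singleton _)]
    refine measure_mono_null (fun x hx hxP => hne ⟨x, hxP, hx⟩) hPnull
  have := Finset.injOn_of_surjOn_of_card_le (s := hPfin.toFinset) (t := hPfin.toFinset) f
    (by simpa using hmaps) (by simpa using hsurj) le_rfl
  simpa using this

section Empiric

variable {X : Type*} [MeasurableSpace X] {m : Measure X} {f : X → X}

lemma lintegral_prod_iterate_le (hf : Measurable f) {U : Set X} (hU : MeasurableSet U)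
    {a b τ : ℝ≥0∞}
    (ha : ∀ g : X → ℝ≥0∞, Measurable g → ∫⁻ x in U, g (f x) ∂m ≤ a * ∫⁻ x, g x ∂m)
    (hb : ∀ g : X → ℝ≥0∞, Measurable g → ∫⁻ x, g (f x) ∂m ≤ b * ∫⁻ x, g x ∂m)
    {w : X → ℝ≥0∞} (hw : Measurable w) (hw1 : ∀ x, w x ≤ 1) (hwU : ∀ x ∉ U, w x ≤ τ) (n : ℕ) :
    ∫⁻ x, ∏ j ∈ Finset.range n, w (f^[j] x) ∂m ≤ (a + τ * b) ^ n * m univ := by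
  induction n with
  | zero => simp
  | succ n ih =>
    have hg : Measurable fun x => ∏ j ∈ Finset.range n, w (f^[j] x) :=
      Finset.measurable_prod _ fun j _ => hw.comp (hf.iterate j)
    simp only [Finset.prod_range_succ', Function.iterate_succ_apply, Function.iterate_zero_apply]
    rw [← lintegral_add_compl _ hU, pow_succ', mul_assoc]
    refine le_trans ?_ (mul_le_mul_right ih _)
    rw [add_mul]
    refine add_le_add ((lintegral_mono fun x => mul_le_of_le_one_right' (hw1 x)).trans (ha _ hg)) ?_
    calc ∫⁻ x in Uᶜ, (∏ j ∈ Finset.range n, w (f^[j] (f x))) * w x ∂m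
        ≤ ∫⁻ x in Uᶜ, τ * ∏ j ∈ Finset.range n, w (f^[j] (f x)) ∂m :=
          setLIntegral_mono' hU.compl fun x hx => by
            rw [mul_comm]
            exact mul_le_mul_left (hwU x hx) _
      _ ≤ ∫⁻ x, τ * ∏ j ∈ Finset.range n, w (f^[j] (f x)) ∂m := setLIntegral_le_lintegral _ _
      _ = τ * ∫⁻ x, ∏ j ∈ Finset.range n, w (f^[j] (f x)) ∂m :=
          lintegral_const_mul _ (hg.comp hf)
      _ ≤ _ := by
          rw [mul_assoc]
          exact mul_le_mul_right (hb _ hg) _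

variable [TopologicalSpace X] [OpensMeasurableSpace X]

lemma integral_empiric (φ : BoundedContinuousFunction X ℝ) (x : X) (n : ℕ) :
    ∫ y, φ y ∂(empiric f x n : Measure X) =
      ((n : ℝ) + 1)⁻¹ * ∑ j ∈ Finset.range (n + 1), φ (f^[j] x) := by
  have hm : StronglyMeasurable φ := φ.continuous.measurable.stronglyMeasurable
  change ∫ y, φ y ∂(((n : ℝ≥0∞) + 1)⁻¹ • ∑ j ∈ Finset.range (n + 1), Measure.dirac (f^[j] x)) = _
  rw [integral_smul_measure, integral_finsetSum_measure fun j _ => φ.integrable _]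
  simp only [integral_dirac' _ _ hm, smul_eq_mul]
  congr 1
  rw [ENNReal.toReal_inv, ENNReal.toReal_add (by simp) (by simp)]
  simp

/-- If orbits cannot linger in `U` without an exponential loss of volume, then almost every point
has all its empirical limit measures giving definite weight to the complement of `U`. -/
lemma exists_ae_forall_pomega_le_integral [IsFiniteMeasure m] (hf : Measurable f) {U : Set X}
    (hU : MeasurableSet U) {a b : ℝ} (ha0 : 0 ≤ a) (ha1 : a < 1) (hb0 : 0 ≤ b)
    (ha : ∀ g : X → ℝ≥0∞, Measurable g →
      ∫⁻ x in U, g (f x) ∂m ≤ ENNReal.ofReal a * ∫⁻ x, g x ∂m)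
    (hb : ∀ g : X → ℝ≥0∞, Measurable g →
      ∫⁻ x, g (f x) ∂m ≤ ENNReal.ofReal b * ∫⁻ x, g x ∂m)
    (φ : BoundedContinuousFunction X ℝ) (hφ0 : ∀ x, 0 ≤ φ x) (hφU : ∀ x ∉ U, φ x = 1) :
    ∃ δ > 0, ∀ᵐ x ∂m, ∀ ν ∈ pomega f x, δ ≤ ∫ y, φ y ∂(ν : Measure X) := by
  obtain ⟨c, hc, hc0⟩ : ∃ c : ℝ, a + Real.exp (-c) * b < 1 ∧ 0 < c := by
    have h : Tendsto (fun c : ℝ => a + Real.exp (-c) * b) atTop (𝓝 (a + 0 * b)) :=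
      (Real.tendsto_exp_neg_atTop_nhds_zero.mul_const b).const_add a
    exact ((h.eventually_lt_const (by simpa using ha1)).and (eventually_gt_atTop 0)).exists
  set ρ := a + Real.exp (-c) * b
  have hρ0 : 0 ≤ ρ := by positivity
  obtain ⟨δ, hδ, hδ0⟩ : ∃ δ : ℝ, ρ * Real.exp (c * δ) < 1 ∧ 0 < δ := by
    have h : Tendsto (fun δ : ℝ => ρ * Real.exp (c * δ)) (𝓝[>] 0) (𝓝 (ρ * Real.exp (c * 0))) :=
      (Continuous.tendsto (by fun_prop) 0).mono_left nhdsWithin_le_nhds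
    exact ((h.eventually_lt_const (by simpa using hc)).and self_mem_nhdsWithin).exists
  refine ⟨δ, hδ0, ?_⟩
  set w : X → ℝ≥0∞ := fun x => ENNReal.ofReal (Real.exp (-(c * φ x))) with hw
  have hwm : Measurable w := by
    have := φ.continuous.measurable
    fun_prop
  have hprod : ∀ n x, ∏ j ∈ Finset.range n, w (f^[j] x) =
      ENNReal.ofReal (Real.exp (-(c * ∑ j ∈ Finset.range n, φ (f^[j] x)))) := fun n x => by
    rw [← ENNReal.ofReal_prod_of_nonneg fun _ _ => (Real.exp_pos _).le, ← Real.exp_sum,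
      Finset.sum_neg_distrib, Finset.mul_sum]
  have hI : ∀ n, ∫⁻ x, ∏ j ∈ Finset.range n, w (f^[j] x) ∂m ≤ ENNReal.ofReal ρ ^ n * m univ := by
    intro n
    have := lintegral_prod_iterate_le (τ := ENNReal.ofReal (Real.exp (-c))) hf hU ha hb hwm
      (fun x => by
        rw [hw, ← ENNReal.ofReal_one]
        exact ENNReal.ofReal_le_ofReal
          (Real.exp_le_one_iff.2 (neg_nonpos.2 (mul_nonneg hc0.le (hφ0 x)))))
      (fun x hx => by simp [hw, hφU x hx]) n
    rwa [← ENNReal.ofReal_mul (Real.exp_pos _).le, ← ENNReal.ofReal_add ha0 (by positivity)]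
      at this
  set s : ℕ → Set X := fun n => {x | ∫ y, φ y ∂(empiric f x n : Measure X) < δ} with hs
  have hbound : ∀ n, m (s n) ≤ ENNReal.ofReal (ρ * Real.exp (c * δ)) ^ (n + 1) * m univ := by
    intro n
    have hsub : s n ⊆ {x | ENNReal.ofReal (Real.exp (-(c * δ))) ^ (n + 1) ≤
        ∏ j ∈ Finset.range (n + 1), w (f^[j] x)} := by
      intro x hx
      rw [hs, mem_ofPred, integral_empiric, inv_mul_lt_iff₀ (by positivity)] at hx
      rw [mem_ofPred, hprod, ← ENNReal.ofReal_pow (Real.exp_pos _).le, ← Real.exp_nat_mul]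
      refine ENNReal.ofReal_le_ofReal (Real.exp_le_exp.2 ?_)
      have := mul_le_mul_of_nonneg_left hx.le hc0.le
      push_cast
      linarith
    have hmarkov := mul_meas_ge_le_lintegral (μ := m)
      (Finset.measurable_prod (Finset.range (n + 1)) fun j _ => hwm.comp (hf.iterate j))
      (ENNReal.ofReal (Real.exp (-(c * δ))) ^ (n + 1))
    have hone : ENNReal.ofReal (Real.exp (c * δ)) ^ (n + 1) *
        ENNReal.ofReal (Real.exp (-(c * δ))) ^ (n + 1) = 1 := by
      rw [← mul_pow, ← ENNReal.ofReal_mul (Real.exp_pos _).le, ← Real.exp_add]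
      simp
    calc m (s n) = ENNReal.ofReal (Real.exp (c * δ)) ^ (n + 1) *
          (ENNReal.ofReal (Real.exp (-(c * δ))) ^ (n + 1) * m (s n)) := by
            rw [← mul_assoc, hone, one_mul]
      _ ≤ ENNReal.ofReal (Real.exp (c * δ)) ^ (n + 1) *
          (ENNReal.ofReal ρ ^ (n + 1) * m univ) := by
            refine mul_le_mul_right ((mul_le_mul_right (measure_mono hsub) _).trans ?_) _
            refine hmarkov.trans ?_
            exact hI (n + 1)
      _ = _ := by
            rw [ENNReal.ofReal_mul hρ0, mul_pow, ← mul_assoc, mul_comm (_ ^ _) (_ ^ _)]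
  have hsum : ∑' n, m (s n) ≠ ∞ := by
    refine ne_top_of_le_ne_top ?_ (ENNReal.tsum_le_tsum hbound)
    rw [ENNReal.tsum_mul_right]
    refine ENNReal.mul_ne_top ?_ (measure_ne_top _ _)
    have hlt : ENNReal.ofReal (ρ * Real.exp (c * δ)) < 1 := by
      rw [← ENNReal.ofReal_one]
      exact (ENNReal.ofReal_lt_ofReal_iff one_pos).2 hδ
    simp only [pow_succ']
    rw [ENNReal.tsum_mul_left, ENNReal.tsum_geometric]
    exact ENNReal.mul_ne_top ENNReal.ofReal_ne_top
      (ENNReal.inv_ne_top.2 (tsub_pos_of_lt hlt).ne')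
  filter_upwards [ae_eventually_notMem hsum] with x hx ν hν
  by_contra hlt
  have hnhds : {ν : ProbabilityMeasure X | ∫ y, φ y ∂(ν : Measure X) < δ} ∈ 𝓝 ν :=
    (isOpen_lt (ProbabilityMeasure.continuous_integral_boundedContinuousFunction φ)
      continuous_const).mem_nhds (not_le.1 hlt)
  exact (MapClusterPt.frequently hν hnhds) hx

end Empiric

/-- A `C¹` expanding map of the circle has no atomic ergodic observable measure. -/
theorem no_atomic_ergodic_observable_of_expanding
    (D : CompatibleMetric (ProbabilityMeasure UnitAddCircle))
    (f : UnitAddCircle → UnitAddCircle) (F : ℝ → ℝ)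
    (hF : ContDiff ℝ 1 F) (d : ℤ) (hper : ∀ x : ℝ, F (x + 1) = F x + (d : ℝ))
    (hexp : ∀ x : ℝ, 1 < deriv F x)
    (hlift : ∀ x : ℝ, f (x : UnitAddCircle) = ((F x : ℝ) : UnitAddCircle)) :
    ¬ ∃ μ : ProbabilityMeasure UnitAddCircle,
        (∀ E : Set UnitAddCircle, MeasurableSet E →
          μ.toMeasure (f ⁻¹' E) = μ.toMeasure E) ∧
        Ergodic f μ.toMeasure ∧
        (∃ A : Set UnitAddCircle, A.Finite ∧ μ.toMeasure Aᶜ = 0) ∧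
        Observable D (volume : Measure UnitAddCircle) f μ := by
  rintro ⟨μ, hinv, -, ⟨A, hA, hμA⟩, hobs⟩
  have hFd : Differentiable ℝ F := hF.differentiable one_ne_zero
  have hFinj : Function.Injective F :=
    (strictMono_of_deriv_pos fun x => one_pos.trans (hexp x)).injective
  have hfc : Continuous f := continuous_of_lift hFd.continuous hlift
  obtain ⟨z, -, hz⟩ := isCompact_Icc.exists_isMinOn (nonempty_Icc.2 zero_le_one)
    (hF.continuous_deriv le_rfl).continuousOn
  have hz0 : 0 < deriv F z := one_pos.trans (hexp z)
  obtain ⟨P, hP, hμP, hPinj⟩ := exists_injOn_of_invariant_of_finite hinv hA hμA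
  obtain ⟨V, hVP, hVinj⟩ := hPinj.exists_mem_nhdsSet hP.isCompact
    (fun x _ => hfc.continuousAt)
    (fun x _ => exists_mem_nhds_injOn_of_lift hFd.continuous hFinj hlift x)
  obtain ⟨U, hUo, hPU, hUV⟩ := mem_nhdsSet_iff_exists.1 hVP
  obtain ⟨ψ, hψ0, hψ1, hψ⟩ := exists_continuous_zero_one_of_isClosed hP.isClosed
    hUo.isClosed_compl (disjoint_compl_right_iff_subset.2 hPU)
  set φ : BoundedContinuousFunction UnitAddCircle ℝ := BoundedContinuousFunction.mkOfCompact ψ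
  obtain ⟨b, hb0, hb⟩ := exists_lintegral_comp_le hFd hFinj hz0 hz hlift
  obtain ⟨δ, hδ, hae⟩ := exists_ae_forall_pomega_le_integral hfc.measurable hUo.measurableSet
    (inv_nonneg.2 hz0.le) (inv_lt_one_of_one_lt₀ (hexp z)) hb0
    (fun g hg => setLIntegral_comp_le_of_injOn hFd hFinj hz0 hz hlift hUo.measurableSet
      (hVinj.mono hUV) hg) hb φ (fun x => (hψ x).1) (fun x hx => hψ1 hx)
  have hμφ : ∫ y, φ y ∂(μ : Measure UnitAddCircle) = 0 :=
    integral_eq_zero_of_ae (measure_mono_null (fun x hx hxP => hx (hψ0 hxP)) hμP)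
  have hnhds : {ν : ProbabilityMeasure UnitAddCircle |
      ∫ y, φ y ∂(ν : Measure UnitAddCircle) < δ} ∈ 𝓝 μ :=
    (isOpen_lt (ProbabilityMeasure.continuous_integral_boundedContinuousFunction φ)
      continuous_const).mem_nhds (by rwa [mem_ofPred, hμφ])
  obtain ⟨ε, hε, hsub⟩ := (D.nhds_iff μ _).1 hnhds
  refine (hobs ε hε).ne' (measure_mono_null ?_ hae)
  rintro x ⟨ν, hν, hd⟩ hx
  exact (hx ν hν).not_gt (hsub (mem_ofPred.2 (D.symm μ ν ▸ hd)))
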